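/- Let Λ be a right 4-Nakayama artin algebra and let M be a finitely generated indecomposable non-local 4-factor serial right Λ-module whose socle is not simple. Then l(M) = 4, rad(M) = soc(M) = S1 ⊕ S2 is a direct sum of two simple submodules, l(top(M)) = 2, and M has exactly two maximal submodules: one of them is an indecomposable 2-factor serial module N1 of length 3, and the other decomposes as N2 ⊕ S1, where N2 is a uniserial submodule of length 2 with soc(N2) = S2. -/

import Mathlib

/-! Basic definitions for (right) modules over a ring: radical, socle, length,
uniserial, local, indecomposable, `n`-factor serial, right `n`-Nakayama algebras,
Nakayama algebras and almost split sequences. -/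

universe u v w

section ModuleDefs

variable (A : Type v) [Ring A] (M : Type w) [AddCommGroup M] [Module A M]

/-- The composition length of a module, i.e. the Krull dimension of its submodule lattice. -/
noncomputable def moduleLength : WithBot ℕ∞ := Order.krullDim (Submodule A M)

/-- The radical of a module: the intersection of all its maximal submodules. -/
def moduleRad : Submodule A M := sInf {N : Submodule A M | IsCoatom N}

/-- The socle of a module: the sum of all its simple submodules. -/
def moduleSoc : Submodule A M := sSup {N : Submodule A M | IsAtom N}

variable {A M}

/-- The radical of a submodule `N`, viewed as a submodule of the ambient module. -/
def radOf (N : Submodule A M) : Submodule A M :=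
  Submodule.map N.subtype (moduleRad A ↥N)

/-- The socle of a submodule `N`, viewed as a submodule of the ambient module. -/
def socOf (N : Submodule A M) : Submodule A M :=
  Submodule.map N.subtype (moduleSoc A ↥N)

variable (A M)

/-- The iterated radical `rad^n(M)`, as a submodule of `M`. -/
def radPow : ℕ → Submodule A M
  | 0 => ⊤
  | n + 1 => radOf (radPow n)

/-- A module is uniserial if its submodules are totally ordered by inclusion. -/
def IsUniserialModule : Prop := ∀ N P : Submodule A M, N ≤ P ∨ P ≤ N

/-- A module is local if it has a unique maximal submodule. -/
def IsLocalModule : Prop := ∃! N : Submodule A M, IsCoatom N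

/-- A module is colocal if its socle is a simple submodule. -/
def IsColocalModule : Prop := IsAtom (moduleSoc A M)

/-- A module is indecomposable if it is nonzero and is not the direct sum of two
nonzero submodules. -/
def IsIndecModule : Prop :=
  Nontrivial M ∧ ∀ N P : Submodule A M, IsCompl N P → N = ⊥ ∨ P = ⊥

/-- The Loewy length of a module: the least `n` with `rad^n(M) = 0`. -/
noncomputable def loewyLength : ℕ := sInf {n : ℕ | radPow A M n = ⊥}

/-- A module `M` of length `l` is `n`-factor serial (`l ≥ n > 1`) if it is not uniserial,
`M/rad^{l-n}(M)` is uniserial and `M/rad^{l-n+1}(M)` is not uniserial. -/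
def IsNFactorSerial (n : ℕ) : Prop :=
  1 < n ∧ ¬ IsUniserialModule A M ∧
  ∃ l : ℕ, moduleLength A M = l ∧ n ≤ l ∧
    IsUniserialModule A (M ⧸ radPow A M (l - n)) ∧
    ¬ IsUniserialModule A (M ⧸ radPow A M (l - n + 1))

/-- `M` is `n`-factor serial, where `1`-factor serial means uniserial. -/
def IsFactorSerial (n : ℕ) : Prop :=
  (n = 1 ∧ IsUniserialModule A M) ∨ IsNFactorSerial A M n

end ModuleDefs

section AlgebraDefs

variable (Λ : Type u) [Ring Λ]

/-- A ring `Λ` is right `n`-Nakayama if every finitely generated indecomposable right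
`Λ`-module is `i`-factor serial for some `1 ≤ i ≤ n`, and there is at least one finitely
generated indecomposable `n`-factor serial right `Λ`-module.  Right `Λ`-modules are
realized as left `Λᵐᵒᵖ`-modules. -/
def IsRightNNakayama (n : ℕ) : Prop :=
  (∀ M : ModuleCat.{u} Λᵐᵒᵖ, Module.Finite Λᵐᵒᵖ M → IsIndecModule Λᵐᵒᵖ M →
      ∃ i, 1 ≤ i ∧ i ≤ n ∧ IsFactorSerial Λᵐᵒᵖ M i) ∧
  ∃ M : ModuleCat.{u} Λᵐᵒᵖ, Module.Finite Λᵐᵒᵖ M ∧ IsIndecModule Λᵐᵒᵖ M ∧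
    IsNFactorSerial Λᵐᵒᵖ M n

/-- A ring `Λ` is a Nakayama algebra if every finitely generated indecomposable projective
right `Λ`-module and every finitely generated indecomposable projective left `Λ`-module is
uniserial. -/
def IsNakayamaAlgebra : Prop :=
  (∀ M : ModuleCat.{u} Λᵐᵒᵖ, Module.Finite Λᵐᵒᵖ M → Module.Projective Λᵐᵒᵖ M →
      IsIndecModule Λᵐᵒᵖ M → IsUniserialModule Λᵐᵒᵖ M) ∧
  (∀ M : ModuleCat.{u} Λ, Module.Finite Λ M → Module.Projective Λ M →
      IsIndecModule Λ M → IsUniserialModule Λ M)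

end AlgebraDefs

section AlmostSplit

variable {A : Type v} [Ring A]

/-- A pair of maps `f : X → Y`, `g : Y → Z` is an almost split (Auslander-Reiten) sequence
if `0 → X → Y → Z → 0` is a non-split short exact sequence with `X` and `Z` indecomposable,
such that every homomorphism `V → Z` from a finitely generated module which is not a split
epimorphism factors through `g`. -/
def IsAlmostSplitSequence {X Y Z : Type w} [AddCommGroup X] [Module A X]
    [AddCommGroup Y] [Module A Y] [AddCommGroup Z] [Module A Z]
    (f : X →ₗ[A] Y) (g : Y →ₗ[A] Z) : Prop :=
  Function.Injective f ∧ Function.Surjective g ∧ LinearMap.range f = LinearMap.ker g ∧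
  (¬ ∃ s : Z →ₗ[A] Y, g ∘ₗ s = LinearMap.id) ∧
  IsIndecModule A X ∧ IsIndecModule A Z ∧
  ∀ V : ModuleCat.{w} A, Module.Finite A V →
    ∀ h : V →ₗ[A] Z, (¬ ∃ s : Z →ₗ[A] V, h ∘ₗ s = LinearMap.id) →
      ∃ k : V →ₗ[A] Y, g ∘ₗ k = h

end AlmostSplit

section Len

variable {A : Type v} [Ring A] {M : Type w} [AddCommGroup M] [Module A M]

/-- The composition length of a submodule as a natural number (`0` if it is infinite). -/
noncomputable def Submodule.len (U : Submodule A M) : ℕ := (Module.length A U).toNat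

variable [IsNoetherian A M] [IsArtinian A M]

theorem Submodule.coe_len (U : Submodule A M) : (U.len : ℕ∞) = Module.length A U :=
  ENat.natCast_toNat Module.length_ne_top

theorem moduleLength_eq_length (X : Type*) [AddCommGroup X] [Module A X] :
    moduleLength A X = Module.length A X :=
  (Module.coe_length A X).symm

theorem moduleLength_submodule_eq {U : Submodule A M} {n : ℕ} (h : U.len = n) :
    moduleLength A U = n := by
  rw [moduleLength_eq_length, ← U.coe_len, h]
  rfl

theorem Submodule.len_strictMono : StrictMono (Submodule.len : Submodule A M → ℕ) := by
  intro U V h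
  rw [← Nat.cast_lt (α := ℕ∞), coe_len, coe_len, Module.length_submodule, Module.length_submodule]
  exact Submodule.height_strictMono h

theorem Submodule.len_mono {U V : Submodule A M} (h : U ≤ V) : U.len ≤ V.len :=
  len_strictMono.monotone h

theorem Submodule.eq_of_le_of_len_le {U V : Submodule A M} (h : U ≤ V) (hl : V.len ≤ U.len) :
    U = V :=
  h.eq_of_not_lt fun hlt => (len_strictMono hlt).not_ge hl

omit [IsNoetherian A M] [IsArtinian A M] in
@[simp] theorem Submodule.len_bot : (⊥ : Submodule A M).len = 0 := by
  simp [Submodule.len]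

theorem Submodule.len_eq_zero {U : Submodule A M} : U.len = 0 ↔ U = ⊥ := by
  refine ⟨fun h => ?_, fun h => by simp [h]⟩
  exact (eq_of_le_of_len_le bot_le (by simp [h])).symm

theorem Submodule.len_eq_one {U : Submodule A M} : U.len = 1 ↔ IsAtom U := by
  rw [← isSimpleModule_iff_isAtom, ← Module.length_eq_one_iff, ← U.coe_len]
  norm_cast

theorem Submodule.length_quotient_add_len (U : Submodule A M) :
    (U.len : ℕ∞) + Module.length A (M ⧸ U) = (⊤ : Submodule A M).len := by
  rw [coe_len, coe_len, Module.length_top]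
  exact (Module.length_eq_add_of_exact U.subtype U.mkQ U.subtype_injective U.mkQ_surjective
    (LinearMap.exact_subtype_mkQ U)).symm

theorem Submodule.len_add_one_of_isCoatom {U : Submodule A M} (h : IsCoatom U) :
    U.len + 1 = (⊤ : Submodule A M).len := by
  have := isSimpleModule_iff_isCoatom.2 h
  have h1 := U.length_quotient_add_len
  rw [Module.length_eq_one] at h1
  exact_mod_cast h1

/-- Rank-nullity for composition length. -/
theorem Submodule.len_map_add_len_inf_ker {X : Type*} [AddCommGroup X] [Module A X]
    [IsNoetherian A X] [IsArtinian A X] (f : M →ₗ[A] X) (U : Submodule A M) :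
    (U.map f).len + (U ⊓ LinearMap.ker f).len = U.len := by
  have h := Module.length_eq_add_of_exact (LinearMap.ker (f.domRestrict U)).subtype
    (f.domRestrict U).rangeRestrict (Submodule.subtype_injective _)
    (LinearMap.surjective_rangeRestrict _)
    (by
      intro x
      simp [Subtype.ext_iff])
  have e1 : LinearMap.range (f.domRestrict U) = U.map f := LinearMap.range_domRestrict U f
  have e2 : Module.length A (LinearMap.ker (f.domRestrict U)) =
      Module.length A ↥(U ⊓ LinearMap.ker f) := by
    rw [LinearMap.ker_domRestrict]
    have : (LinearMap.ker f).comap U.subtype = (LinearMap.ker f).submoduleOf U := rfl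
    rw [← Submodule.map_comap_subtype]
    exact (Submodule.equivMapOfInjective _ U.subtype_injective _).length_eq
  rw [e1, e2, ← coe_len, ← coe_len, ← coe_len] at h
  have : U.len = (U ⊓ LinearMap.ker f).len + (U.map f).len := by exact_mod_cast h
  omega

theorem Submodule.len_sup_add_len_inf (U V : Submodule A M) :
    (U ⊔ V).len + (U ⊓ V).len = U.len + V.len := by
  have h1 := len_map_add_len_inf_ker V.mkQ U
  have h2 := len_map_add_len_inf_ker V.mkQ (U ⊔ V)
  rw [Submodule.ker_mkQ] at h1 h2
  have h3 : (U ⊔ V).map V.mkQ = U.map V.mkQ := by simp [Submodule.map_sup]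
  have h4 : (U ⊔ V) ⊓ V = V := inf_eq_right.2 le_sup_right
  rw [h3, h4] at h2
  omega

omit [IsNoetherian A M] [IsArtinian A M] in
theorem Submodule.len_range_of_injective {X : Type*} [AddCommGroup X] [Module A X]
    [IsNoetherian A X] [IsArtinian A X] {U : Submodule A M} (f : U →ₗ[A] X)
    (hf : Function.Injective f) : (LinearMap.range f).len = U.len := by
  rw [len, len, (LinearEquiv.ofInjective f hf).length_eq]

end Len

section RadSoc

variable {A : Type v} [Ring A] {M : Type w} [AddCommGroup M] [Module A M]

theorem radPow_one_eq : radPow A M 1 = sInf {N : Submodule A M | IsCoatom N} := by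
  have e : (Submodule.topEquiv : (⊤ : Submodule A M) ≃ₗ[A] M).toLinearMap =
      (⊤ : Submodule A M).subtype := rfl
  have h : (moduleRad A (⊤ : Submodule A M)) = Module.jacobson A _ := rfl
  change (moduleRad A (⊤ : Submodule A M)).map (⊤ : Submodule A M).subtype = Module.jacobson A M
  rw [h, ← e]
  exact Module.map_jacobson_of_bijective (Submodule.topEquiv).bijective

theorem radPow_antitone : Antitone (radPow A M) :=
  antitone_nat_of_succ_le fun _ => Submodule.map_subtype_le _ _

theorem coatoms_subsingleton_of_uniserial_quotient {K : Submodule A M}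
    (hK : ∀ P : Submodule A M, IsCoatom P → K ≤ P) (h : IsUniserialModule A (M ⧸ K))
    {P Q : Submodule A M} (hP : IsCoatom P) (hQ : IsCoatom Q) : P = Q := by
  have key : ∀ {P Q : Submodule A M}, IsCoatom P → IsCoatom Q →
      P.map K.mkQ ≤ Q.map K.mkQ → P = Q := by
    intro P Q hP hQ h
    have h1 := Submodule.comap_mono (f := K.mkQ) h
    rw [Submodule.comap_map_mkQ, Submodule.comap_map_mkQ, sup_eq_right.2 (hK P hP),
      sup_eq_right.2 (hK Q hQ)] at h1
    exact (hP.le_iff_eq hQ.1).1 h1 |>.symm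
  rcases h (P.map K.mkQ) (Q.map K.mkQ) with h | h
  · exact key hP hQ h
  · exact (key hQ hP h).symm

theorem IsFactorSerial.coatoms_subsingleton {n i : ℕ} (h : IsFactorSerial A M i) (hi : i ≤ n)
    (hn : ((n + 1 : ℕ) : WithBot ℕ∞) ≤ moduleLength A M)
    {P Q : Submodule A M} (hP : IsCoatom P) (hQ : IsCoatom Q) : P = Q := by
  rcases h with ⟨-, h⟩ | ⟨-, -, l, hl, -, h, -⟩
  · rcases h P Q with h | h
    · exact ((hP.le_iff_eq hQ.1).1 h).symm
    · exact (hQ.le_iff_eq hP.1).1 h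
  · refine coatoms_subsingleton_of_uniserial_quotient (fun P hP => ?_) h hP hQ
    rw [hl] at hn
    have hn' : n + 1 ≤ l := by exact_mod_cast hn
    refine (radPow_antitone (show 1 ≤ l - i by omega)).trans ?_
    rw [radPow_one_eq]
    exact sInf_le hP

end RadSoc
section TwoByTwo

variable {A : Type v} [Ring A] {M : Type w} [AddCommGroup M] [Module A M]

/-- An indecomposable module of length `4` whose submodule `J` of length `2` is a sum of two simple
submodules, lies in all maximal submodules and contains all simple submodules. -/
structure IsTwoByTwo (J : Submodule A M) : Prop where
  eq_bot_or_eq_bot : ∀ U V : Submodule A M, IsCompl U V → U = ⊥ ∨ V = ⊥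
  len_top : (⊤ : Submodule A M).len = 4
  len_eq : J.len = 2
  atom_le : ∀ S : Submodule A M, IsAtom S → S ≤ J
  le_coatom : ∀ P : Submodule A M, IsCoatom P → J ≤ P
  exists_isAtom : ∃ S T : Submodule A M, IsAtom S ∧ IsAtom T ∧ S ⊔ T = J

/-- All proper submodules of `N` are contained in `J`. -/
def ProperLE (N J : Submodule A M) : Prop := ∀ U < N, U ≤ J

theorem ProperLE.apply_eq_zero {N J : Submodule A M} (hN : ProperLE N J) (hJN : J < N)
    [IsSemisimpleModule A J] {f : N →ₗ[A] M} (hf : ∀ n, f n ∈ J) {n : N} (hn : (n : M) ∈ J) :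
    f n = 0 := by
  have hrad : n ∈ Module.jacobson A N := by
    rw [Module.jacobson, Submodule.mem_sInf]
    intro P hP
    have hlt : P.map N.subtype < N := by
      refine (Submodule.map_subtype_le _ _).lt_of_ne fun h => hP.1 ?_
      rw [← Submodule.comap_map_eq_of_injective N.subtype_injective P, h, Submodule.comap_subtype_self]
    have hle : P ≤ J.comap N.subtype := Submodule.map_le_iff_le_comap.1 (hN _ hlt)
    have hne : J.comap N.subtype ≠ ⊤ := fun h => hJN.not_ge (Submodule.comap_subtype_eq_top.1 h)
    exact (hP.le_iff_eq hne).1 hle ▸ hn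
  have h := Module.map_jacobson_le (f.codRestrict J hf) (Submodule.mem_map_of_mem hrad)
  rw [IsSemisimpleModule.jacobson_eq_bot] at h
  exact congrArg Subtype.val ((Submodule.mem_bot A).1 h)

theorem ProperLE.inf_coatom_le {N N' J : Submodule A M} (hNJ : ProperLE N J) (hN : IsCoatom N)
    (hN' : IsCoatom N') (hne : N ≠ N') : N ⊓ N' ≤ J :=
  hNJ _ (inf_lt_left.2 fun hle => hne ((hN.le_iff_eq hN'.1).1 hle).symm)

namespace IsTwoByTwo

variable [IsNoetherian A M] [IsArtinian A M] {J : Submodule A M}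

section

variable (h : IsTwoByTwo J)
include h

omit [IsNoetherian A M] [IsArtinian A M] in
theorem semisimple : IsSemisimpleModule A J := by
  obtain ⟨S, T, hS, hT, rfl⟩ := h.exists_isAtom
  have := isSimpleModule_iff_isAtom.2 hS
  have := isSimpleModule_iff_isAtom.2 hT
  exact IsSemisimpleModule.sup inferInstance inferInstance

theorem exists_isAtom_sup_eq {S : Submodule A M} (hS : IsAtom S) :
    ∃ T : Submodule A M, IsAtom T ∧ T ≠ S ∧ T ⊔ S = J := by
  obtain ⟨T, T', hT, hT', hsup⟩ := h.exists_isAtom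
  have key : ∀ {T : Submodule A M}, IsAtom T → T ≠ S → T ⊔ S = J := by
    intro T hT hne
    have h1 := Submodule.len_sup_add_len_inf T S
    rw [(hT.disjoint_of_ne hS hne).eq_bot, Submodule.len_eq_one.2 hT, Submodule.len_eq_one.2 hS,
      Submodule.len_bot] at h1
    have h2 := h.len_eq
    exact Submodule.eq_of_le_of_len_le (sup_le (h.atom_le T hT) (h.atom_le S hS)) (by omega)
  by_cases hne : T = S
  · have hne' : T' ≠ S := by
      rintro rfl
      rw [hne, sup_idem] at hsup
      have h1 := Submodule.len_eq_one.2 hS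
      have h2 := h.len_eq
      rw [← hsup] at h2
      omega
    exact ⟨T', hT', hne', key hT' hne'⟩
  · exact ⟨T, hT, hne, key hT hne⟩

theorem len_coatom {P : Submodule A M} (hP : IsCoatom P) : P.len = 3 := by
  have := Submodule.len_add_one_of_isCoatom hP
  have := h.len_top
  omega

theorem isCoatom_of_len {P : Submodule A M} (hP : P.len = 3) : IsCoatom P := by
  have htop := h.len_top
  refine ⟨fun e => by subst e; omega, fun Q hQ => ?_⟩
  have h1 := Submodule.len_strictMono hQ
  exact Submodule.eq_of_le_of_len_le le_top (by omega)

theorem lt_coatom {P : Submodule A M} (hP : IsCoatom P) : J < P := by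
  refine (h.le_coatom P hP).lt_of_ne fun e => ?_
  have h1 := h.len_coatom hP
  have h2 := h.len_eq
  rw [e] at h2
  omega

theorem of_not_le {C U : Submodule A M} (hC : IsCoatom C) (hU : U < C) (hUJ : ¬ U ≤ J) :
    U.len = 2 ∧ IsAtom (U ⊓ J) ∧ U ⊔ J = C := by
  have hJC := h.lt_coatom hC
  have hC3 := h.len_coatom hC
  have hJ2 := h.len_eq
  have hle : U ⊔ J ≤ C := sup_le hU.le hJC.le
  have hlt : J < U ⊔ J := right_lt_sup.2 hUJ
  have h1 := Submodule.len_strictMono hlt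
  have h2 := Submodule.len_mono hle
  have h3 := Submodule.len_strictMono hU
  have hsup : U ⊔ J = C := Submodule.eq_of_le_of_len_le hle (by omega)
  have hmod := Submodule.len_sup_add_len_inf U J
  have hne : U ⊓ J ≠ ⊥ := by
    intro e
    rw [e, Submodule.len_bot] at hmod
    exact hUJ (h.atom_le U (Submodule.len_eq_one.1 (by omega)))
  have hpos : (U ⊓ J).len ≠ 0 := mt Submodule.len_eq_zero.1 hne
  have hU2 : U.len = 2 := by omega
  exact ⟨hU2, Submodule.len_eq_one.1 (by omega), hsup⟩

theorem eq_of_not_properLE {C C' : Submodule A M} (hC : IsCoatom C) (hC' : IsCoatom C')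
    (hd : ¬ ProperLE C J) (hd' : ¬ ProperLE C' J) : C = C' := by
  by_contra hne
  simp only [ProperLE, not_forall] at hd hd'
  obtain ⟨U, hU, hUJ⟩ := hd
  obtain ⟨U', hU', hUJ'⟩ := hd'
  obtain ⟨h1, h2, h3⟩ := h.of_not_le hC hU hUJ
  obtain ⟨h1', h2', h3'⟩ := h.of_not_le hC' hU' hUJ'
  have htop : C ⊔ C' = ⊤ := 
    hC.2 _ (left_lt_sup.2 fun hle => hne ((hC'.le_iff_eq hC.1).1 hle))
  have hsup : U ⊔ U' = ⊤ := by
    by_contra hs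
    obtain ⟨P, hP, hle⟩ := (eq_top_or_exists_le_coatom (U ⊔ U')).resolve_left hs
    have hJP := h.le_coatom P hP
    apply hP.1
    rw [eq_top_iff, ← htop, ← h3, ← h3']
    exact sup_le (sup_le (le_sup_left.trans hle) hJP) (sup_le (le_sup_right.trans hle) hJP)
  have hmod := Submodule.len_sup_add_len_inf U U'
  rw [hsup, h.len_top] at hmod
  have hinf : U ⊓ U' = ⊥ := Submodule.len_eq_zero.1 (by omega)
  rcases h.eq_bot_or_eq_bot U U' (IsCompl.of_eq hinf hsup) with e | e
  · exact hUJ (e ▸ bot_le)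
  · exact hUJ' (e ▸ bot_le)

end

end IsTwoByTwo

/-- The amalgam of two submodules along a common submodule `S`. -/
theorem exists_amalgam [IsNoetherian A M] [IsArtinian A M] (N N' S : Submodule A M) (hS : S ≤ N) (hS' : S ≤ N') :
    ∃ (X : Type w) (_ : AddCommGroup X) (_ : Module A X) (_ : IsNoetherian A X) (_ : IsArtinian A X)
      (i : N →ₗ[A] X) (i' : N' →ₗ[A] X)
      (p : X →ₗ[A] M), (∀ n, p (i n) = n) ∧ (∀ n, p (i' n) = n) ∧
        LinearMap.range i ⊔ LinearMap.range i' = ⊤ ∧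
        ∀ n n', i n = i' n' ↔ (n : M) = n' ∧ (n : M) ∈ S := by
  let d : S →ₗ[A] N × N' := (Submodule.inclusion hS).prod (-Submodule.inclusion hS')
  let K := LinearMap.range d
  refine ⟨(N × N') ⧸ K, inferInstance, inferInstance, inferInstance, inferInstance,
    K.mkQ ∘ₗ LinearMap.inl A N N',
    K.mkQ ∘ₗ LinearMap.inr A N N', K.liftQ (N.subtype.coprod N'.subtype) ?_, ?_, ?_, ?_, ?_⟩
  · rintro _ ⟨s, rfl⟩
    simp [d]
  · intro n
    simp
  · intro n
    simp
  · rw [LinearMap.range_comp, LinearMap.range_comp, ← Submodule.map_sup,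
      LinearMap.sup_range_inl_inr, Submodule.map_top, Submodule.range_mkQ]
  · intro n n'
    simp only [LinearMap.comp_apply, Submodule.mkQ_apply, Submodule.Quotient.eq]
    constructor
    · rintro ⟨s, hs⟩
      have h1 : (s : M) = n := by simpa [d] using congrArg (fun z => (z.1 : M)) hs
      have h2 : (s : M) = n' := by simpa [d] using congrArg (fun z => (z.2 : M)) hs
      exact ⟨h1.symm.trans h2, h1 ▸ s.2⟩
    · rintro ⟨h1, h2⟩
      refine ⟨⟨n, h2⟩, ?_⟩
      ext <;> simp [d, h1]

end TwoByTwo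
section Amalgam

variable {A : Type v} [Ring A] {M : Type w} [AddCommGroup M] [Module A M]
  [IsNoetherian A M] [IsArtinian A M] {J : Submodule A M}

namespace IsTwoByTwo

variable (h : IsTwoByTwo J) {N N' S : Submodule A M}
  (hN : IsCoatom N) (hN' : IsCoatom N') (hne : N ≠ N')
  (hNJ : ProperLE N J) (hNJ' : ProperLE N' J) (hS : IsAtom S)
  {X : Type w} [AddCommGroup X] [Module A X] [IsNoetherian A X] [IsArtinian A X]
  {i : N →ₗ[A] X} {i' : N' →ₗ[A] X} {p : X →ₗ[A] M}
  (hi : ∀ n, p (i n) = n) (hi' : ∀ n, p (i' n) = n)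
  (hsup : LinearMap.range i ⊔ LinearMap.range i' = ⊤)
  (hglue : ∀ n n', i n = i' n' ↔ (n : M) = n' ∧ (n : M) ∈ S)

include hi in
omit [IsNoetherian A M] [IsArtinian A M] [IsNoetherian A X] [IsArtinian A X] in
theorem section_injective : Function.Injective i := fun a b hab => by
  rw [Subtype.ext_iff, ← hi a, ← hi b, hab]

include hN hN' hne hi hi' in
omit [IsNoetherian A M] [IsArtinian A M] [IsNoetherian A X] [IsArtinian A X] in
theorem range_amalgam : LinearMap.range p = ⊤ := by
  have h1 : (⊤ : Submodule A M) = N ⊔ N' :=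
    (hN.2 _ (left_lt_sup.2 fun hle => hne ((hN'.le_iff_eq hN.1).1 hle))).symm
  rw [eq_top_iff, h1]
  exact sup_le (fun n hn => ⟨i ⟨n, hn⟩, hi _⟩) (fun n hn => ⟨i' ⟨n, hn⟩, hi' _⟩)

include h hN hN' hS hi hi' hsup hglue in
theorem len_amalgam : (⊤ : Submodule A X).len = 5 := by
  have h1 := Submodule.len_sup_add_len_inf (LinearMap.range i) (LinearMap.range i')
  rw [hsup, Submodule.len_range_of_injective i (section_injective hi),
    Submodule.len_range_of_injective i' (section_injective hi'), h.len_coatom hN,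
    h.len_coatom hN'] at h1
  have h2 := Submodule.len_map_add_len_inf_ker p (LinearMap.range i ⊓ LinearMap.range i')
  have h3 : (LinearMap.range i ⊓ LinearMap.range i') ⊓ LinearMap.ker p = ⊥ := by
    rw [eq_bot_iff]
    rintro _ ⟨⟨⟨n, rfl⟩, -⟩, hn⟩
    have : n = 0 := by simpa [hi] using hn
    simp [this]
  have h4 : (LinearMap.range i ⊓ LinearMap.range i').map p = S := by
    apply le_antisymm
    · rintro _ ⟨_, ⟨⟨n, rfl⟩, ⟨n', hn'⟩⟩, rfl⟩
      rw [hi]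
      exact ((hglue n n').1 hn'.symm).2
    · intro s hs
      have hsJ := h.atom_le S hS hs
      refine ⟨i ⟨s, h.le_coatom N hN hsJ⟩, ⟨⟨_, rfl⟩, ⟨⟨s, h.le_coatom N' hN' hsJ⟩, ?_⟩⟩, hi _⟩
      exact ((hglue _ _).2 ⟨rfl, hs⟩).symm
  rw [h3, h4, Submodule.len_bot, Submodule.len_eq_one.2 hS] at h2
  omega

include h hN hN' hne hS hi hi' hsup hglue in
theorem isAtom_ker_amalgam : IsAtom (LinearMap.ker p) := by
  have h1 := Submodule.len_map_add_len_inf_ker p ⊤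
  rw [Submodule.map_top, range_amalgam hN hN' hne hi hi', top_inf_eq,
    h.len_amalgam hN hN' hS hi hi' hsup hglue, h.len_top] at h1
  exact Submodule.len_eq_one.1 (by omega)

include h hN hN' hne hNJ hNJ' hi hi' hsup in
omit [IsNoetherian A X] [IsArtinian A X] in
theorem ker_amalgam_le {B : Submodule A X} (hB : IsCoatom B) : LinearMap.ker p ≤ B := by
  have key : ∀ {P : Submodule A M} {f : P →ₗ[A] X}, IsCoatom P → ProperLE P J →
      ∀ n : P, (n : M) ∈ J → f n ∈ B := by
    intro P f hP hPJ n hn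
    rw [← Submodule.mem_comap]
    have hJP : J.comap P.subtype ≠ ⊤ := fun e =>
      (h.lt_coatom hP).not_ge (Submodule.comap_subtype_eq_top.1 e)
    rcases Submodule.isCoatom_comap_or_eq_top f hB with hc | hc
    · have hlt : (B.comap f).map P.subtype < P := by
        refine (Submodule.map_subtype_le _ _).lt_of_ne fun e => hc.1 ?_
        rw [← Submodule.comap_map_eq_of_injective P.subtype_injective (B.comap f), e,
          Submodule.comap_subtype_self]
      have hle : B.comap f ≤ J.comap P.subtype := Submodule.map_le_iff_le_comap.1 (hPJ _ hlt)
      exact (hc.le_iff_eq hJP).1 hle ▸ hn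
    · rw [hc]
      trivial
  intro x hx
  have hxt : x ∈ LinearMap.range i ⊔ LinearMap.range i' := hsup ▸ Submodule.mem_top
  obtain ⟨_, ⟨n, rfl⟩, _, ⟨n', rfl⟩, rfl⟩ := Submodule.mem_sup.1 hxt
  have h0 : (n : M) + n' = 0 := by simpa [hi, hi'] using hx
  have hn : (n : M) ∈ J := by
    refine hNJ.inf_coatom_le hN hN' hne ⟨n.2, ?_⟩
    rw [eq_neg_of_add_eq_zero_left h0]
    exact neg_mem n'.2
  have hn' : (n' : M) ∈ J := by
    rw [eq_neg_of_add_eq_zero_right h0]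
    exact neg_mem hn
  exact add_mem (key hN hNJ n hn) (key hN' hNJ' n' hn')

include h hN hN' hne hNJ hNJ' hS hi hi' hsup hglue in
theorem disjoint_ker_amalgam {U V : Submodule A X} (hUV : IsCompl U V) (hV : V ≠ ⊥) :
    Disjoint U (LinearMap.ker p) := by
  have hL := h.isAtom_ker_amalgam hN hN' hne hS hi hi' hsup hglue
  by_contra hd
  have hLU : LinearMap.ker p ≤ U := by
    by_contra hle
    exact hd (hL.not_le_iff_disjoint.1 hle).symm
  have hdis : Disjoint (U.map p) (V.map p) := by
    rw [Submodule.disjoint_def]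
    rintro _ ⟨u, hu, rfl⟩ ⟨x, hx, hxu⟩
    have : x - u ∈ U := hLU (by simp [hxu])
    have hx0 := (Submodule.disjoint_def.1 hUV.disjoint) x (by simpa using add_mem this hu) hx
    rw [← hxu, hx0, map_zero]
  have hcod : U.map p ⊔ V.map p = ⊤ := by
    rw [← Submodule.map_sup, hUV.sup_eq_top, Submodule.map_top,
      range_amalgam hN hN' hne hi hi']
  rcases h.eq_bot_or_eq_bot _ _ (IsCompl.of_eq hdis.eq_bot hcod) with e | e
  · have hUL : U = LinearMap.ker p := le_antisymm (LinearMap.le_ker_iff_map.2 e) hLU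
    have hVc : IsCoatom V := hUV.isAtom_iff_isCoatom.1 (hUL ▸ hL)
    have hLV := h.ker_amalgam_le hN hN' hne hNJ hNJ' hi hi' hsup hVc
    exact hL.1 (le_bot_iff.1 (hUV.disjoint hLU hLV))
  · have hVL : V ≤ LinearMap.ker p := LinearMap.le_ker_iff_map.2 e
    exact hV (le_bot_iff.1 (hUV.disjoint (hVL.trans hLU) le_rfl))

include h hN hN' hne hNJ hNJ' hS hi hi' hsup hglue in
theorem len_lt_four_amalgam {U V : Submodule A X} (hUV : IsCompl U V) (hV : V ≠ ⊥) :
    U.len < 4 := by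
  have hL := h.isAtom_ker_amalgam hN hN' hne hS hi hi' hsup hglue
  have hdis := h.disjoint_ker_amalgam hN hN' hne hNJ hNJ' hS hi hi' hsup hglue hUV hV
  have h1 := Submodule.len_sup_add_len_inf U V
  rw [hUV.sup_eq_top, hUV.inf_eq_bot, h.len_amalgam hN hN' hS hi hi' hsup hglue,
    Submodule.len_bot] at h1
  have h2 : V.len ≠ 0 := mt Submodule.len_eq_zero.1 hV
  by_contra hlt
  have hVa : IsAtom V := Submodule.len_eq_one.1 (by omega)
  have hU : IsCoatom U := hUV.symm.isAtom_iff_isCoatom.1 hVa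
  have hLU := h.ker_amalgam_le hN hN' hne hNJ hNJ' hi hi' hsup hU
  exact hL.1 (le_bot_iff.1 (hdis hLU le_rfl))

include h hN hN' hne hNJ hNJ' hS hi hi' hsup hglue in
theorem exists_retraction_of_len {U V : Submodule A X} (hUV : IsCompl U V) (hU : U.len = 3)
    (hV : V.len = 2) :
    ∃ θ : N' →ₗ[A] M, (∀ n, θ n ∈ N) ∧ (∀ n : N', (n : M) = θ n ↔ (n : M) ∈ S) ∧
      ∃ C : Submodule A M, IsCoatom C ∧ ¬ ProperLE C J ∧ ∀ n : N', (n : M) - θ n ∈ C := by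
  have hV0 : V ≠ ⊥ := fun e => by simp [e] at hV
  have hU0 : U ≠ ⊥ := fun e => by simp [e] at hU
  have hdU := h.disjoint_ker_amalgam hN hN' hne hNJ hNJ' hS hi hi' hsup hglue hUV hV0
  have hdV := h.disjoint_ker_amalgam hN hN' hne hNJ hNJ' hS hi hi' hsup hglue hUV.symm hU0
  have hpU : (U.map p).len = 3 := by
    have h1 := Submodule.len_map_add_len_inf_ker p U
    rw [hdU.eq_bot, Submodule.len_bot] at h1
    omega
  have hpV : (V.map p).len = 2 := by
    have h1 := Submodule.len_map_add_len_inf_ker p V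
    rw [hdV.eq_bot, Submodule.len_bot] at h1
    omega
  have hcod : U.map p ⊔ V.map p = ⊤ := by
    rw [← Submodule.map_sup, hUV.sup_eq_top, Submodule.map_top,
      range_amalgam hN hN' hne hi hi']
  have hUc := h.isCoatom_of_len hpU
  have hVU : ¬ V.map p ≤ U.map p := fun hle => hUc.1 (by rwa [sup_eq_left.2 hle] at hcod)
  have hVJ : ¬ V.map p ≤ J := fun hle => hVU (hle.trans (h.le_coatom _ hUc))
  have hC : IsCoatom (V.map p ⊔ J) := by
    have h1 := Submodule.len_sup_add_len_inf (V.map p) J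
    have h2 := Submodule.len_strictMono (right_lt_sup.2 hVJ)
    have hJ := h.len_eq
    refine h.isCoatom_of_len ?_
    have h3 : (V.map p ⊓ J).len ≠ 0 := by
      intro e
      have hinf := Submodule.len_eq_zero.1 e
      have hs : V.map p ⊔ J = ⊤ := by
        refine Submodule.eq_of_le_of_len_le le_top ?_
        rw [h.len_top]
        omega
      rcases h.eq_bot_or_eq_bot _ _ (IsCompl.of_eq hinf hs) with e | e
      · exact hVJ (e ▸ bot_le)
      · rw [e, Submodule.len_bot] at hJ
        omega
    omega
  have hCd : ¬ ProperLE (V.map p ⊔ J) J := by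
    intro hl
    refine hVJ (hl _ (le_sup_left.lt_of_ne fun e => ?_))
    have := h.len_coatom hC
    rw [← e] at this
    omega
  have hUd : ProperLE (U.map p) J := by
    by_contra hd
    exact hVU ((h.eq_of_not_properLE hUc hC hd hCd).symm ▸ le_sup_left)
  have := h.semisimple
  -- the projection of `N` to `U` along `V` is injective
  have hdisj : Disjoint (LinearMap.range i) V := by
    let q : N →ₗ[A] M := p ∘ₗ U.projection V hUV ∘ₗ i
    have hqU : ∀ n, q n ∈ U.map p := fun n =>
      Submodule.mem_map_of_mem (Submodule.projection_apply_mem hUV _)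
    have hqJ : ¬ ∀ n, q n ∈ J := by
      intro hq
      have hle : J ≤ V.map p := by
        intro x hx
        let n : N := ⟨x, h.le_coatom N hN hx⟩
        have h0 : q n = 0 := hNJ.apply_eq_zero (h.lt_coatom hN) hq hx
        have h1 : U.projection V hUV (i n) = 0 :=
          Submodule.disjoint_def.1 hdU _ (Submodule.projection_apply_mem hUV _) h0
        exact ⟨i n, (Submodule.projection_apply_eq_zero_iff hUV).1 h1, hi n⟩
      exact hVJ (Submodule.eq_of_le_of_len_le hle (by rw [hpV, h.len_eq])).ge
    have hqr : LinearMap.range q = U.map p := by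
      have hle : LinearMap.range q ≤ U.map p := by
        rintro _ ⟨n, rfl⟩
        exact hqU n
      by_contra hlt
      exact hqJ fun n => hUd _ (hle.lt_of_ne hlt) ⟨n, rfl⟩
    have hker : LinearMap.ker q = ⊥ := by
      have h1 := Submodule.len_map_add_len_inf_ker q ⊤
      have h2 : (⊤ : Submodule A N).len = 3 := by
        rw [← h.len_coatom hN, Submodule.len, Submodule.len, Module.length_top]
      rw [Submodule.map_top, hqr, top_inf_eq, hpU, h2] at h1
      exact Submodule.len_eq_zero.1 (by omega)
    rw [Submodule.disjoint_def]
    rintro _ ⟨n, rfl⟩ hn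
    have : q n = 0 := by
      simp only [q, LinearMap.comp_apply, (Submodule.projection_apply_eq_zero_iff hUV).2 hn,
        map_zero]
    have hn0 : n ∈ LinearMap.ker q := this
    rw [hker, Submodule.mem_bot] at hn0
    rw [hn0, map_zero]
  have hcompl : IsCompl (LinearMap.range i) V := by
    refine IsCompl.of_eq hdisj.eq_bot (Submodule.eq_of_le_of_len_le le_top ?_)
    have h1 := Submodule.len_sup_add_len_inf (LinearMap.range i) V
    rw [hdisj.eq_bot, Submodule.len_bot, Submodule.len_range_of_injective i (section_injective hi),
      h.len_coatom hN] at h1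
    rw [h.len_amalgam hN hN' hS hi hi' hsup hglue]
    omega
  let r := (LinearMap.range i).projection V hcompl
  have hrV : ∀ x, x - r x ∈ V := fun x => by
    rw [← Submodule.projection_apply_eq_zero_iff hcompl, map_sub, sub_eq_zero]
    exact (Submodule.projection_apply_of_mem_left hcompl
      (Submodule.projection_apply_mem hcompl x)).symm
  refine ⟨p ∘ₗ r ∘ₗ i', fun n => ?_, fun n => ⟨fun hn => ?_, fun hn => ?_⟩, _, hC, hCd,
    fun n => ?_⟩
  · obtain ⟨m, hm⟩ := Submodule.projection_apply_mem hcompl (i' n)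
    have : p (r (i' n)) = m := by rw [← hm, hi]
    simp only [LinearMap.comp_apply, this, m.2]
  · have h0 : i' n - r (i' n) = 0 := by
      refine Submodule.disjoint_def.1 hdV _ (hrV _) ?_
      rw [LinearMap.mem_ker, map_sub, hi', sub_eq_zero]
      exact hn
    obtain ⟨m, hm⟩ := Submodule.projection_apply_mem hcompl (i' n)
    obtain ⟨h1, h2⟩ := (hglue m n).1 (hm.trans (sub_eq_zero.1 h0).symm)
    exact h1 ▸ h2
  · have hnN : (n : M) ∈ N := h.le_coatom N hN (h.atom_le S hS hn)
    have h1 : i ⟨n, hnN⟩ = i' n := (hglue _ _).2 ⟨rfl, hn⟩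
    have h2 : r (i' n) = i' n :=
      Submodule.projection_apply_of_mem_left hcompl (h1 ▸ LinearMap.mem_range_self i _)
    simp only [LinearMap.comp_apply, h2, hi']
  · refine Submodule.mem_sup_left ⟨i' n - r (i' n), hrV _, ?_⟩
    rw [map_sub, hi']
    rfl

end IsTwoByTwo

end Amalgam
section Structure

variable {A : Type v} [Ring A] {M : Type w} [AddCommGroup M] [Module A M]

/-- Indecomposable modules of length at least `5` have at most one maximal submodule. -/
def LongIndecLocal (A : Type v) [Ring A] : Prop :=
  ∀ (X : Type w) [AddCommGroup X] [Module A X] [Module.Finite A X], IsIndecModule A X →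
    ((4 + 1 : ℕ) : WithBot ℕ∞) ≤ moduleLength A X →
      ∀ P Q : Submodule A X, IsCoatom P → IsCoatom Q → P = Q

theorem not_isUniserialModule_quotient_bot {K : Submodule A M} (hK : K = ⊥)
    (h : ¬ IsUniserialModule A M) : ¬ IsUniserialModule A (M ⧸ K) := by
  subst hK
  refine fun hu => h fun N P => ?_
  have key : ∀ {N P : Submodule A M},
      N.map (⊥ : Submodule A M).mkQ ≤ P.map (⊥ : Submodule A M).mkQ → N ≤ P := by
    intro N P hle
    have h1 := Submodule.comap_mono (f := (⊥ : Submodule A M).mkQ) hle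
    rwa [Submodule.comap_map_mkQ, Submodule.comap_map_mkQ, bot_sup_eq, bot_sup_eq] at h1
  exact (hu _ _).imp key key

theorem isUniserialModule_quotient_of_isCoatom {K : Submodule A M} (hK : IsCoatom K) :
    IsUniserialModule A (M ⧸ K) := by
  have := isSimpleModule_iff_isCoatom.2 hK
  intro N P
  rcases eq_bot_or_eq_top N with rfl | rfl
  · exact Or.inl bot_le
  · exact Or.inr le_top

theorem ProperLE.isCoatom_iff {C J : Submodule A M} (hCJ : ProperLE C J) (hlt : J < C)
    (P : Submodule A C) :
    IsCoatom P ↔ P = J.comap C.subtype := by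
  have hJ : J.comap C.subtype ≠ ⊤ := fun e => hlt.not_ge (Submodule.comap_subtype_eq_top.1 e)
  have hmap : ∀ P : Submodule A C, P ≠ ⊤ → P.map C.subtype < C := fun P hP =>
    (Submodule.map_subtype_le _ _).lt_of_ne fun e => hP <| by
      rw [← Submodule.comap_map_eq_of_injective C.subtype_injective P, e,
        Submodule.comap_subtype_self]
  have hle : ∀ P : Submodule A C, P ≠ ⊤ → P ≤ J.comap C.subtype := fun P hP =>
    Submodule.map_le_iff_le_comap.1 (hCJ _ (hmap P hP))
  refine ⟨fun hP => ((hP.le_iff_eq hJ).1 (hle P hP.1)).symm, ?_⟩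
  rintro rfl
  exact ⟨hJ, fun Q hQ => by_contra fun hne => hQ.not_ge (hle Q hne)⟩

namespace IsTwoByTwo

variable [IsNoetherian A M] [IsArtinian A M] {J : Submodule A M} (h : IsTwoByTwo J)
include h

theorem exists_retraction (hlong : LongIndecLocal.{v, w} A) {N N' S : Submodule A M}
    (hN : IsCoatom N) (hN' : IsCoatom N') (hne : N ≠ N')
    (hNJ : ProperLE N J) (hNJ' : ProperLE N' J) (hS : IsAtom S) :
    ∃ θ : N' →ₗ[A] M, (∀ n, θ n ∈ N) ∧ (∀ n : N', (n : M) = θ n ↔ (n : M) ∈ S) ∧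
      ∃ C : Submodule A M, IsCoatom C ∧ ¬ ProperLE C J ∧ ∀ n : N', (n : M) - θ n ∈ C := by
  have hSJ := h.atom_le S hS
  obtain ⟨X, _, _, _, _, i, i', p, hi, hi', hsup, hglue⟩ := exists_amalgam N N' S
    (hSJ.trans (h.le_coatom N hN)) (hSJ.trans (h.le_coatom N' hN'))
  have hlen := h.len_amalgam hN hN' hS hi hi' hsup hglue
  have hsurj := LinearMap.range_eq_top.1 (range_amalgam hN hN' hne hi hi')
  have hnot : ¬ IsIndecModule A X := by
    intro hX
    refine hne (Submodule.comap_injective_of_surjective hsurj (hlong X hX ?_ _ _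
      ((Submodule.isCoatom_comap_iff hsurj).2 hN) ((Submodule.isCoatom_comap_iff hsurj).2 hN')))
    rw [moduleLength_eq_length, ← Module.length_top, ← Submodule.coe_len, hlen]
    rfl
  have hnt : Nontrivial X := by
    by_contra hX
    rw [not_nontrivial_iff_subsingleton] at hX
    rw [Subsingleton.elim (⊤ : Submodule A X) ⊥, Submodule.len_bot] at hlen
    omega
  simp only [IsIndecModule, hnt, true_and, not_forall, not_or] at hnot
  obtain ⟨U, V, hUV, hU, hV⟩ := hnot
  have h1 := h.len_lt_four_amalgam hN hN' hne hNJ hNJ' hS hi hi' hsup hglue hUV hV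
  have h2 := h.len_lt_four_amalgam hN hN' hne hNJ hNJ' hS hi hi' hsup hglue hUV.symm hU
  have h3 := Submodule.len_sup_add_len_inf U V
  rw [hUV.sup_eq_top, hUV.inf_eq_bot, hlen, Submodule.len_bot] at h3
  rcases (by omega : U.len = 3 ∧ V.len = 2 ∨ V.len = 3 ∧ U.len = 2) with ⟨h4, h5⟩ | ⟨h4, h5⟩
  · exact h.exists_retraction_of_len hN hN' hne hNJ hNJ' hS hi hi' hsup hglue hUV h4 h5
  · exact h.exists_retraction_of_len hN hN' hne hNJ hNJ' hS hi hi' hsup hglue hUV.symm h4 h5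

theorem eq_of_properLE (hlong : LongIndecLocal.{v, w} A) {N N' : Submodule A M}
    (hN : IsCoatom N) (hN' : IsCoatom N') (hNJ : ProperLE N J) (hNJ' : ProperLE N' J) :
    N = N' := by
  by_contra hne
  obtain ⟨S, _, hS, -, -⟩ := h.exists_isAtom
  obtain ⟨T, hT, hTS, -⟩ := h.exists_isAtom_sup_eq hS
  obtain ⟨θ, hθN, hθS, C, hC, hCd, hθC⟩ := h.exists_retraction hlong hN hN' hne hNJ hNJ' hS
  obtain ⟨η, hηN, hηT, C', hC', hCd', hηC⟩ := h.exists_retraction hlong hN hN' hne hNJ hNJ' hT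
  obtain rfl := h.eq_of_not_properLE hC hC' hCd hCd'
  have hNC : N ≠ C := fun e => hCd (e ▸ hNJ)
  have hmem : ∀ n, (θ - η) n ∈ J := fun n => by
    refine hNJ.inf_coatom_le hN hC hNC ⟨sub_mem (hθN n) (hηN n), ?_⟩
    have := sub_mem (hηC n) (hθC n)
    rwa [sub_sub_sub_cancel_left] at this
  have := h.semisimple
  obtain ⟨t, ht, ht0⟩ := T.ne_bot_iff.1 hT.1
  have htJ := h.atom_le T hT ht
  let n : N' := ⟨t, h.le_coatom N' hN' htJ⟩
  have h0 : θ n - η n = 0 := hNJ'.apply_eq_zero (h.lt_coatom hN') hmem htJ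
  have h1 : (n : M) = θ n := ((hηT n).2 ht).trans (sub_eq_zero.1 h0).symm
  exact ht0 (Submodule.disjoint_def.1 (hT.disjoint_of_ne hS hTS) t ht ((hθS n).1 h1))

theorem isIndecModule_of_properLE {C : Submodule A M} (hC : IsCoatom C) (hCJ : ProperLE C J) :
    IsIndecModule A C := by
  have hlt := h.lt_coatom hC
  have hJ : J.comap C.subtype ≠ ⊤ := fun e => hlt.not_ge (Submodule.comap_subtype_eq_top.1 e)
  have hco := hCJ.isCoatom_iff hlt
  refine ⟨Submodule.nontrivial_iff_ne_bot.2 (bot_le.trans_lt hlt).ne', fun P Q hPQ => ?_⟩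
  have key : ∀ P : Submodule A C, P ≠ ⊤ → P ≤ J.comap C.subtype := fun P hP => by
    obtain ⟨R, hR, hle⟩ := (eq_top_or_exists_le_coatom P).resolve_left hP
    exact hle.trans ((hco R).1 hR).le
  by_cases hP : P = ⊤
  · exact Or.inr (by simpa [hP] using hPQ.inf_eq_bot)
  by_cases hQ : Q = ⊤
  · exact Or.inl (by simpa [hQ] using hPQ.inf_eq_bot)
  exact absurd (top_le_iff.1 (hPQ.sup_eq_top ▸ sup_le (key P hP) (key Q hQ))) hJ

theorem isNFactorSerial_of_properLE {C : Submodule A M} (hC : IsCoatom C) (hCJ : ProperLE C J) :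
    IsNFactorSerial A C 2 := by
  have hlt := h.lt_coatom hC
  have hco := hCJ.isCoatom_iff hlt
  have hrad1 : radPow A C 1 = J.comap C.subtype := by
    rw [radPow_one_eq]
    simp only [hco, Set.ofPred_eq_eq_singleton, sInf_singleton]
  have hrad2 : radPow A C 2 = ⊥ := by
    change radOf (radPow A C 1) = ⊥
    have := h.semisimple
    have : IsSemisimpleModule A (radPow A C 1) := by
      rw [hrad1]
      exact IsSemisimpleModule.congr (Submodule.comapSubtypeEquivOfLe hlt.le)
    have hj : moduleRad A (radPow A C 1) = ⊥ := IsSemisimpleModule.jacobson_eq_bot A _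
    rw [radOf, hj, Submodule.map_bot]
  have hnu : ¬ IsUniserialModule A C := by
    intro hu
    obtain ⟨S, _, hS, -, -⟩ := h.exists_isAtom
    obtain ⟨T, hT, hTS, -⟩ := h.exists_isAtom_sup_eq hS
    have hSC := (h.atom_le S hS).trans hlt.le
    have hTC := (h.atom_le T hT).trans hlt.le
    have key : ∀ {S T : Submodule A M}, S ≤ C →
        S.comap C.subtype ≤ T.comap C.subtype → S ≤ T := fun hSC hle x hx =>
      hle (show (⟨x, hSC hx⟩ : C) ∈ _ from hx)
    rcases hu (S.comap C.subtype) (T.comap C.subtype) with hle | hle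
    · exact hTS ((hT.le_iff_eq hS.1).1 (key hSC hle)).symm
    · exact hTS ((hS.le_iff_eq hT.1).1 (key hTC hle))
  refine ⟨by norm_num, hnu, 3, moduleLength_submodule_eq (h.len_coatom hC), by norm_num, ?_, ?_⟩
  · exact isUniserialModule_quotient_of_isCoatom (by rw [hrad1]; exact (hco _).2 rfl)
  · exact not_isUniserialModule_quotient_bot hrad2 hnu

theorem eq_of_submodule_not_le {U : Submodule A M} (hU : U.len = 2) (hUJ : IsAtom (U ⊓ J))
    (Q : Submodule A U) : Q = ⊥ ∨ Q = (U ⊓ J).comap U.subtype ∨ Q = ⊤ := by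
  have hle := Submodule.map_subtype_le U Q
  have hlen := Submodule.len_mono hle
  have hQ := Submodule.comap_map_eq_of_injective U.subtype_injective Q
  rcases (by omega : (Q.map U.subtype).len = 0 ∨ (Q.map U.subtype).len = 1 ∨
    (Q.map U.subtype).len = 2) with h0 | h1 | h2
  · left
    rw [← hQ, Submodule.len_eq_zero.1 h0, Submodule.comap_bot, Submodule.ker_subtype]
  · right; left
    have ha := Submodule.len_eq_one.1 h1
    have := (hUJ.le_iff_eq ha.1).1 (le_inf hle (h.atom_le _ ha))
    rw [← this, hQ]
  · right; right
    rw [← hQ, Submodule.eq_of_le_of_len_le hle (by omega), Submodule.comap_subtype_self]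

theorem isUniserialModule_of_isAtom_inf {U : Submodule A M} (hU : U.len = 2)
    (hUJ : IsAtom (U ⊓ J)) : IsUniserialModule A U := by
  intro N P
  rcases h.eq_of_submodule_not_le hU hUJ N with rfl | rfl | rfl
  · exact Or.inl bot_le
  · rcases h.eq_of_submodule_not_le hU hUJ P with rfl | rfl | rfl
    · exact Or.inr bot_le
    · exact Or.inl le_rfl
    · exact Or.inl le_top
  · exact Or.inr le_top

theorem socOf_of_isAtom_inf {U : Submodule A M} (hU : U.len = 2)
    (hUJ : IsAtom (U ⊓ J)) : socOf U = U ⊓ J := by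
  have hbot : (U ⊓ J).comap U.subtype ≠ ⊥ := by
    intro e
    have := congrArg (Submodule.map U.subtype) e
    rw [Submodule.map_comap_subtype, Submodule.map_bot, inf_eq_right.2 inf_le_left] at this
    exact hUJ.1 this
  have htop : (U ⊓ J).comap U.subtype ≠ ⊤ := by
    intro e
    have hle := Submodule.comap_subtype_eq_top.1 e
    have h1 := Submodule.len_mono hle
    rw [Submodule.len_eq_one.2 hUJ] at h1
    omega
  have hatoms : {Q : Submodule A U | IsAtom Q} = {(U ⊓ J).comap U.subtype} := by
    ext Q
    simp only [Set.mem_ofPred_eq, Set.mem_singleton_iff]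
    constructor
    · intro hQ
      rcases h.eq_of_submodule_not_le hU hUJ Q with e | e | e
      · exact absurd e hQ.1
      · exact e
      · subst e
        exact absurd ((hQ.le_iff_eq hbot).1 le_top) htop
    · rintro rfl
      refine ⟨hbot, fun Q hQ => ?_⟩
      rcases h.eq_of_submodule_not_le hU hUJ Q with e | e | e
      · exact e
      · exact absurd e hQ.ne
      · exact absurd (e ▸ hQ) not_top_lt
  rw [socOf, moduleSoc, hatoms, sSup_singleton, Submodule.map_comap_subtype,
    inf_eq_right.2 inf_le_left]

end IsTwoByTwo

theorem exists_isTwoByTwo [IsNoetherian A M] [IsArtinian A M]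
    (hdec : ∀ U V : Submodule A M, IsCompl U V → U = ⊥ ∨ V = ⊥)
    (hlen : (⊤ : Submodule A M).len = 4) {P Q : Submodule A M} (hP : IsCoatom P)
    (hQ : IsCoatom Q) (hPQ : P ≠ Q) (hsoc : ¬ IsAtom (moduleSoc A M)) :
    ∃ J : Submodule A M, IsTwoByTwo J ∧ radPow A M 1 = J ∧ moduleSoc A M = J := by
  have hle : ∀ S R : Submodule A M, IsAtom S → IsCoatom R → S ≤ R := by
    intro S R hS hR
    by_contra hSR
    have hsup : S ⊔ R = ⊤ := hR.2 _ (right_lt_sup.2 hSR)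
    rcases hdec S R (IsCompl.of_eq (hS.not_le_iff_disjoint.1 hSR).eq_bot hsup) with e | e
    · exact hS.1 e
    · have h1 := Submodule.len_add_one_of_isCoatom hR
      rw [e, hlen, Submodule.len_bot] at h1
      omega
  have htop : (⊤ : Submodule A M) ≠ ⊥ := fun e => by simp [e] at hlen
  obtain ⟨S, hS, -⟩ := (eq_bot_or_exists_atom_le (⊤ : Submodule A M)).resolve_left htop
  obtain ⟨T, hT, hTS⟩ : ∃ T : Submodule A M, IsAtom T ∧ T ≠ S := by
    by_contra! hall
    have : {N : Submodule A M | IsAtom N} = {S} :=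
      Set.eq_singleton_iff_unique_mem.2 ⟨hS, fun T hT => hall T hT⟩
    rw [moduleSoc, this, sSup_singleton] at hsoc
    exact hsoc hS
  have hJlen : (S ⊔ T).len = 2 := by
    have h1 := Submodule.len_sup_add_len_inf S T
    rw [(hS.disjoint_of_ne hT hTS.symm).eq_bot, Submodule.len_eq_one.2 hT,
      Submodule.len_eq_one.2 hS, Submodule.len_bot] at h1
    omega
  have hPQlen : (P ⊓ Q).len = 2 := by
    have h1 := Submodule.len_sup_add_len_inf P Q
    rw [hP.2 _ (left_lt_sup.2 fun hle => hPQ ((hQ.le_iff_eq hP.1).1 hle)), hlen] at h1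
    have h2 := Submodule.len_add_one_of_isCoatom hP
    have h3 := Submodule.len_add_one_of_isCoatom hQ
    omega
  have hJ : S ⊔ T = P ⊓ Q := Submodule.eq_of_le_of_len_le
    (sup_le (le_inf (hle S P hS hP) (hle S Q hS hQ)) (le_inf (hle T P hT hP) (hle T Q hT hQ)))
    (by omega)
  have hco : ∀ R : Submodule A M, IsCoatom R → S ⊔ T ≤ R := fun R hR =>
    sup_le (hle S R hS hR) (hle T R hT hR)
  have hat : ∀ R : Submodule A M, IsAtom R → R ≤ S ⊔ T := fun R hR => by
    rw [hJ]
    exact le_inf (hle R P hR hP) (hle R Q hR hQ)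
  refine ⟨S ⊔ T, ⟨hdec, hlen, hJlen, hat, hco, S, T, hS, hT, rfl⟩, ?_, ?_⟩
  · rw [radPow_one_eq]
    refine le_antisymm ?_ (le_sInf hco)
    rw [hJ]
    exact le_inf (sInf_le hP) (sInf_le hQ)
  · exact le_antisymm (sSup_le hat) (sup_le (le_sSup hS) (le_sSup hT))

end Structure

theorem structure_of_nonlocal_four_factor_serial_nonsimple_socle
    (R : Type*) [CommRing R] [IsArtinianRing R]
    (Λ : Type u) [Ring Λ] [Algebra R Λ] [Module.Finite R Λ]
    (hΛ : IsRightNNakayama Λ 4)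
    (M : Type u) [AddCommGroup M] [Module Λᵐᵒᵖ M] [Module.Finite Λᵐᵒᵖ M]
    (hind : IsIndecModule Λᵐᵒᵖ M) (hfs : IsNFactorSerial Λᵐᵒᵖ M 4)
    (hnl : ¬ IsLocalModule Λᵐᵒᵖ M) (hncoloc : ¬ IsColocalModule Λᵐᵒᵖ M) :
    moduleLength Λᵐᵒᵖ M = (4 : ℕ) ∧
    moduleLength Λᵐᵒᵖ (M ⧸ radPow Λᵐᵒᵖ M 1) = (2 : ℕ) ∧
    ∃ S1 S2 : Submodule Λᵐᵒᵖ M, IsAtom S1 ∧ IsAtom S2 ∧ S1 ≠ S2 ∧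
      radPow Λᵐᵒᵖ M 1 = moduleSoc Λᵐᵒᵖ M ∧ moduleSoc Λᵐᵒᵖ M = S1 ⊔ S2 ∧
      ∃ C1 C2 : Submodule Λᵐᵒᵖ M, C1 ≠ C2 ∧
        {N : Submodule Λᵐᵒᵖ M | IsCoatom N} = {C1, C2} ∧
        (IsIndecModule Λᵐᵒᵖ ↑C1 ∧ IsNFactorSerial Λᵐᵒᵖ ↑C1 2 ∧
          moduleLength Λᵐᵒᵖ ↑C1 = (3 : ℕ)) ∧
        ∃ N2 : Submodule Λᵐᵒᵖ M, IsUniserialModule Λᵐᵒᵖ ↑N2 ∧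
          moduleLength Λᵐᵒᵖ ↑N2 = (2 : ℕ) ∧ socOf N2 = S2 ∧
          Disjoint N2 S1 ∧ C2 = N2 ⊔ S1 := by
  have hlong : LongIndecLocal.{u, u} Λᵐᵒᵖ := by
    intro X _ _ _ hX hl P Q hP hQ
    obtain ⟨i, -, hi, hi'⟩ := hΛ.1 (ModuleCat.of Λᵐᵒᵖ X) inferInstance hX
    exact hi'.coatoms_subsingleton hi hl hP hQ
  obtain ⟨hnt, hdec⟩ := hind
  obtain ⟨-, -, l, hl, h4l, -, -⟩ := id hfs
  obtain ⟨hnoeth, hart⟩ : IsNoetherian Λᵐᵒᵖ M ∧ IsArtinian Λᵐᵒᵖ M := by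
    rw [← isFiniteLength_iff_isNoetherian_isArtinian, ← Module.length_ne_top_iff]
    intro e
    rw [moduleLength_eq_length, e] at hl
    exact ENat.top_ne_natCast l (WithBot.coe_injective hl)
  obtain ⟨P, hP, -⟩ := (eq_top_or_exists_le_coatom (⊥ : Submodule Λᵐᵒᵖ M)).resolve_left bot_ne_top
  obtain ⟨Q, hQ, hQP⟩ : ∃ Q : Submodule Λᵐᵒᵖ M, IsCoatom Q ∧ Q ≠ P := by
    by_contra! hall
    exact hnl ⟨P, hP, hall⟩
  have hl4 : l = 4 := by
    by_contra hne
    refine hQP (IsFactorSerial.coatoms_subsingleton (n := 4) (Or.inr hfs) le_rfl ?_ hQ hP)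
    rw [hl]
    exact_mod_cast (by omega : 4 + 1 ≤ l)
  subst hl4
  have hlen : (⊤ : Submodule Λᵐᵒᵖ M).len = 4 := by
    have h1 : Module.length Λᵐᵒᵖ M = (4 : ℕ) := by
      rw [moduleLength_eq_length] at hl
      exact WithBot.coe_injective hl
    rw [Submodule.len, Module.length_top, h1, ENat.toNat_natCast]
  obtain ⟨J, h, hrad, hsoc⟩ := exists_isTwoByTwo hdec hlen hP hQ hQP.symm hncoloc
  obtain ⟨C, D, hC, hD, hCJ, hDJ⟩ : ∃ C D : Submodule Λᵐᵒᵖ M, IsCoatom C ∧ IsCoatom D ∧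
      ProperLE C J ∧ ¬ ProperLE D J := by
    by_cases hPJ : ProperLE P J
    · exact ⟨P, Q, hP, hQ, hPJ, fun hQJ => hQP (h.eq_of_properLE hlong hQ hP hQJ hPJ)⟩
    · exact ⟨Q, P, hQ, hP, by_contra fun hQJ => hQP (h.eq_of_not_properLE hQ hP hQJ hPJ), hPJ⟩
  obtain ⟨U, hUD, hUJ⟩ : ∃ U, U < D ∧ ¬ U ≤ J := by
    simpa [ProperLE] using hDJ
  obtain ⟨hU, hat, hsup⟩ := h.of_not_le hD hUD hUJ
  obtain ⟨S, hS, hne, hSJ⟩ := h.exists_isAtom_sup_eq hat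
  refine ⟨hl, ?_, S, U ⊓ J, hS, hat, hne, hrad.trans hsoc.symm, hsoc.trans hSJ.symm, C, D,
    fun e => hDJ (e ▸ hCJ), ?_, ⟨h.isIndecModule_of_properLE hC hCJ,
      h.isNFactorSerial_of_properLE hC hCJ, moduleLength_submodule_eq (h.len_coatom hC)⟩, U,
    h.isUniserialModule_of_isAtom_inf hU hat, moduleLength_submodule_eq hU,
    h.socOf_of_isAtom_inf hU hat, ?_, ?_⟩
  · have h1 := J.length_quotient_add_len
    rw [h.len_eq, hlen] at h1
    rw [hrad, moduleLength_eq_length]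
    have h2 : Module.length Λᵐᵒᵖ (M ⧸ J) ≠ ⊤ := Module.length_ne_top
    obtain ⟨k, hk⟩ := ENat.ne_top_iff_exists.1 h2
    rw [← hk] at h1 ⊢
    have h3 : 2 + k = 4 := by exact_mod_cast h1
    rw [(by omega : k = 2)]
    rfl
  · ext N
    constructor
    · intro hN
      by_cases hNJ : ProperLE N J
      · exact Or.inl (h.eq_of_properLE hlong hN hC hNJ hCJ)
      · exact Or.inr (h.eq_of_not_properLE hN hD hNJ hDJ)
    · rintro (rfl | rfl)
      · exact hC
      · exact hD
  · rw [Submodule.disjoint_def]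
    exact fun x hxU hxS => Submodule.disjoint_def.1 (hS.disjoint_of_ne hat hne) x hxS
      ⟨hxU, h.atom_le S hS hxS⟩
  · rw [← hsup, ← hSJ, sup_comm S, ← sup_assoc, sup_eq_left.2 (inf_le_left : U ⊓ J ≤ U)]
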